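/- arXiv:1001.2125 — 3 statements merged into one kernel-verified Lean document; each statement's English description precedes it below -/
import Mathlib

section
/- Let 0 ≤ n ≤ d be integers, let K ⊆ ℝ^d be a compact set, and assume there exist γ > 0 and a probability measure η on ℝ^d such that η(B_r(x)) ≥ γ·r^n for every x ∈ K and every r ∈ (0,1). Then for every r ∈ (0,2), one has ν^d(K_{⊕r}) / (b_{d−n}·r^{d−n}) ≤ (1/γ)·2^n·4^d·(b_d / b_{d−n}). -/
open MeasureTheory Metric Filter Set
open scoped ENNReal Topology NNReal

/-- The Lebesgue volume `b_k` of the unit ball in `ℝ^k` (with `b_0 = 1`). -/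
noncomputable def ballVol (k : ℕ) : ℝ :=
  (volume (Metric.closedBall (0 : EuclideanSpace ℝ (Fin k)) 1)).toReal

/-- The closed `r`-neighborhood (Minkowski enlargement)
`S_{⊕r} = {x : ∃ y ∈ S, |x - y| ≤ r}` of a set `S ⊆ ℝ^d`. -/
def enlarge {d : ℕ} (S : Set (EuclideanSpace ℝ (Fin d))) (r : ℝ) :
    Set (EuclideanSpace ℝ (Fin d)) := {x | ∃ y ∈ S, dist x y ≤ r}

/-- Integrating the mass of balls of radius `R` over their centers gives the volume of one ball. -/
lemma lintegral_measure_closedBall_le {d : ℕ} (η : Measure (EuclideanSpace ℝ (Fin d)))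
    [IsProbabilityMeasure η] {R : ℝ} (hR : 0 ≤ R) :
    Measurable (fun x => η (closedBall x R)) ∧
      ∫⁻ x, η (closedBall x R) = ENNReal.ofReal (ballVol d * R ^ d) := by
  have hS : MeasurableSet {p : EuclideanSpace ℝ (Fin d) × EuclideanSpace ℝ (Fin d) |
      dist p.2 p.1 ≤ R} :=
    (isClosed_le (continuous_snd.dist continuous_fst) continuous_const).measurableSet
  refine ⟨measurable_measure_prodMk_left hS, ?_⟩
  have hvol : ∀ y : EuclideanSpace ℝ (Fin d),
      volume (closedBall y R) = ENNReal.ofReal (ballVol d * R ^ d) := fun y => by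
    rw [Measure.addHaar_closedBall' _ _ hR, finrank_euclideanSpace_fin, mul_comm, ballVol,
      ENNReal.ofReal_mul ENNReal.toReal_nonneg,
      ENNReal.ofReal_toReal measure_closedBall_lt_top.ne]
  have hswap := (Measure.prod_apply (μ := volume) (ν := η) hS).symm.trans
    (Measure.prod_apply_symm (μ := volume) (ν := η) hS)
  calc ∫⁻ x, η (closedBall x R)
      = ∫⁻ y, volume (closedBall y R) ∂η := by
        refine hswap.trans (lintegral_congr fun y => ?_)
        congr 1
        ext x
        simp [dist_comm]
    _ = ENNReal.ofReal (ballVol d * R ^ d) := by simp [hvol]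

/-- If `η` gives mass at least `m` to every ball of radius `s` centered in `K`, then the
volume of the `r`-neighborhood of `K` times `m` is at most the volume of a ball of radius
`r + s`. -/
lemma mul_volume_enlarge_le {d : ℕ} {K : Set (EuclideanSpace ℝ (Fin d))}
    (η : Measure (EuclideanSpace ℝ (Fin d))) [IsProbabilityMeasure η] {r s : ℝ}
    (hrs : 0 ≤ r + s) {m : ℝ≥0∞} (h : ∀ x ∈ K, m ≤ η (closedBall x s)) :
    m * volume (enlarge K r) ≤ ENNReal.ofReal (ballVol d * (r + s) ^ d) := by
  obtain ⟨hmeas, hint⟩ := lintegral_measure_closedBall_le η hrs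
  rw [← hint]
  refine le_trans ?_ (mul_meas_ge_le_lintegral hmeas m)
  gcongr
  rintro x ⟨y, hy, hxy⟩
  refine (h y hy).trans (measure_mono (closedBall_subset_closedBall' ?_))
  rw [dist_comm]
  linarith

lemma ballVol_pos (k : ℕ) : 0 < ballVol k :=
  ENNReal.toReal_pos (measure_closedBall_pos _ _ one_pos).ne' measure_closedBall_lt_top.ne

/-- Lemma 7: if `K ⊆ ℝ^d` is compact and `η` is a probability measure
with `η(B_r(x)) ≥ γ r^n` for all `x ∈ K`, `r ∈ (0,1)`, then for all `r ∈ (0,2)`,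
`ν^d(K_{⊕r}) / (b_{d−n} r^{d−n}) ≤ (1/γ) 2^n 4^d (b_d / b_{d−n})`. -/
theorem stmt_2 {d n : ℕ} (hnd : n ≤ d) (K : Set (EuclideanSpace ℝ (Fin d)))
    (hK : IsCompact K)
    (γ : ℝ) (hγ : 0 < γ)
    (η : Measure (EuclideanSpace ℝ (Fin d))) (hη : IsProbabilityMeasure η)
    (hlow : ∀ x ∈ K, ∀ r : ℝ, r ∈ Set.Ioo (0 : ℝ) 1 →
      ENNReal.ofReal (γ * r ^ n) ≤ η (Metric.closedBall x r)) :
    ∀ r : ℝ, r ∈ Set.Ioo (0 : ℝ) 2 →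
      volume (enlarge K r) / ENNReal.ofReal (ballVol (d - n) * r ^ (d - n)) ≤
        ENNReal.ofReal ((1 / γ) * 2 ^ n * 4 ^ d * (ballVol d / ballVol (d - n))) := by
  rintro r ⟨hr0, hr2⟩
  have hb := ballVol_pos (d - n)
  have hbd := ballVol_pos d
  have hm : 0 < γ * (r / 2) ^ n := by positivity
  have key := mul_volume_enlarge_le η (r := r) (s := r / 2) (by positivity)
    fun x hx => hlow x hx (r / 2) ⟨by positivity, by linarith⟩
  apply ENNReal.div_le_of_le_mul
  rw [← ENNReal.ofReal_mul (by positivity)]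
  rw [mul_comm, ← ENNReal.le_div_iff_mul_le (Or.inl (by simpa using hm))
    (Or.inl ENNReal.ofReal_ne_top), ← ENNReal.ofReal_div_of_pos hm] at key
  refine key.trans (ENNReal.ofReal_le_ofReal ?_)
  rw [div_le_iff₀ hm]
  calc ballVol d * (r + r / 2) ^ d
      ≤ ballVol d * (4 * r) ^ d := by gcongr; linarith
    _ = ballVol d * (4 ^ d * (r ^ (d - n) * r ^ n)) := by
        rw [pow_sub_mul_pow r hnd, mul_pow]
    _ = _ := by
        rw [div_pow]
        field_simp
end

section
/- Let (Ω, F, P) be a probability space and let 0 ≤ n < d be integers. Let Φ : Ω → ℕ be a random variable with Φ ≥ 1 a.s. and E[Φ] < ∞, and let (E_i)_{i≥1} be maps E_i : Ω → Set(ℝ^d) with each E_i(ω) closed, such that for some fixed x ∈ ℝ^d: for each r > 0 the events A_i(r) := {ω : x ∈ (E_i(ω))_{⊕r}} are measurable and mutually independent with the common probability s(r) := P(A_1(r)) for all i; the σ-algebra generated by Φ is independent of the σ-algebra generated by all events A_i(r), i ≥ 1, r > 0; and P(x ∈ E_1) = 0. If the limit L := lim_{r↓0} s(r) / (b_{d−n}·r^{d−n})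 exists in [0,∞), then lim_{r↓0} P({ω : ∃ i ≤ Φ(ω), x ∈ (E_i(ω))_{⊕r}}) / (b_{d−n}·r^{d−n}) = E[Φ]·L, and lim_{r↓0} E[#{i ≤ Φ : x ∈ (E_i)_{⊕r}}] / (b_{d−n}·r^{d−n}) = E[Φ]·L. -/
open MeasureTheory Metric Filter Set
open scoped ENNReal Topology NNReal

open ProbabilityTheory in
/-- If `A` is an independent sequence of events of probability `s`, the probability that `A i`
is the first of them to occur is `s * (1 - s) ^ i`. -/
lemma measure_inter_biInter_compl_of_iIndepSet {Ω : Type*} [MeasurableSpace Ω] {P : Measure Ω}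
    [IsProbabilityMeasure P] {A : ℕ → Set Ω} (hA : ∀ i, MeasurableSet (A i))
    (hind : iIndepSet A P) {s : ℝ≥0∞} (hs : ∀ i, P (A i) = s) (i : ℕ) :
    P (A i ∩ ⋂ j ∈ Finset.range i, (A j)ᶜ) = s * (1 - s) ^ i := by
  have hgen (j : ℕ) : MeasurableSet[MeasurableSpace.generateFrom {A j}] (A j) :=
    MeasurableSpace.measurableSet_generateFrom rfl
  have h := iIndep.meas_biInter hind (S := Finset.range (i + 1))
    (s := fun j => if j < i then (A j)ᶜ else A j) fun j _ => by
      split_ifs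
      · exact (hgen j).compl
      · exact hgen j
  have hset : (⋂ j ∈ Finset.range (i + 1), if j < i then (A j)ᶜ else A j) =
      A i ∩ ⋂ j ∈ Finset.range i, (A j)ᶜ := by
    rw [Finset.range_add_one, Finset.set_biInter_insert, if_neg (lt_irrefl i)]
    congr 1
    exact iInter₂_congr fun j hj => if_pos (Finset.mem_range.1 hj)
  rw [hset, Finset.prod_range_succ, if_neg (lt_irrefl i), hs] at h
  rw [h, mul_comm]
  congr 1
  rw [Finset.prod_congr rfl fun j hj => ?_, Finset.prod_const, Finset.card_range]
  rw [if_pos (Finset.mem_range.1 hj), prob_compl_eq_one_sub (hA j), hs]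

/-- The expected number of events `A i`, `i < Φ`, that occur. -/
lemma lintegral_sum_range_indicator {Ω : Type*} [MeasurableSpace Ω] (P : Measure Ω)
    {Φ : Ω → ℕ} (hΦ : Measurable Φ) {A : ℕ → Set Ω} (hA : ∀ i, MeasurableSet (A i)) :
    ∫⁻ ω, ∑ i ∈ Finset.range (Φ ω), (A i).indicator (fun _ => (1 : ℝ≥0∞)) ω ∂P =
      ∑' i, P (Φ ⁻¹' Ioi i ∩ A i) := by
  have hm (i : ℕ) : MeasurableSet (Φ ⁻¹' Ioi i ∩ A i) := (hΦ measurableSet_Ioi).inter (hA i)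
  simp_rw [← fun i => lintegral_indicator_one (μ := P) (hm i)]
  rw [← lintegral_tsum fun i => (measurable_one.indicator (hm i)).aemeasurable]
  refine lintegral_congr fun ω => ?_
  rw [tsum_eq_sum (s := Finset.range (Φ ω))]
  · refine Finset.sum_congr rfl fun i hi => ?_
    have hi' : i < Φ ω := Finset.mem_range.1 hi
    by_cases h : ω ∈ A i <;> simp [Set.indicator, h, hi']
  · intro i hi
    have hi' : ¬ i < Φ ω := fun h => hi (Finset.mem_range.2 h)
    simp [Set.indicator, hi']

lemma lintegral_natCast_eq_tsum_measure_lt {Ω : Type*} [MeasurableSpace Ω] (P : Measure Ω)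
    {Φ : Ω → ℕ} (hΦ : Measurable Φ) :
    ∫⁻ ω, (Φ ω : ℝ≥0∞) ∂P = ∑' i, P (Φ ⁻¹' Ioi i) := by
  simpa using lintegral_sum_range_indicator P hΦ (A := fun _ => univ) fun _ => MeasurableSet.univ

open ProbabilityTheory in
/-- The probability that one of the events `A i`, `i < Φ`, occurs, for independent events of
probability `s` that are independent of `Φ`. -/
lemma measure_exists_lt_mem_of_iIndepSet {Ω : Type*} {m : MeasurableSpace Ω}
    [MeasurableSpace Ω] {P : Measure Ω}
    [IsProbabilityMeasure P] {Φ : Ω → ℕ} (hΦ : Measurable Φ) {A : ℕ → Set Ω}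
    (hA : ∀ i, MeasurableSet (A i)) (hind : iIndepSet A P) {s : ℝ≥0∞} (hs : ∀ i, P (A i) = s)
    (hΦm : Indep (MeasurableSpace.comap Φ inferInstance) m P)
    (hAm : ∀ i, MeasurableSet[m] (A i)) :
    P {ω | ∃ i < Φ ω, ω ∈ A i} = s * ∑' i, P (Φ ⁻¹' Ioi i) * (1 - s) ^ i := by
  set C : ℕ → Set Ω := fun i => A i ∩ ⋂ j ∈ Finset.range i, (A j)ᶜ with hC
  have hset : {ω | ∃ i < Φ ω, ω ∈ A i} = ⋃ i, Φ ⁻¹' Ioi i ∩ C i := by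
    classical
    ext ω
    simp only [hC, mem_ofPred_eq, mem_iUnion, mem_inter_iff, mem_preimage, mem_Ioi, mem_iInter,
      Finset.mem_range, mem_compl_iff]
    constructor
    · rintro ⟨i, hi, hω⟩
      have hex : ∃ i, ω ∈ A i := ⟨i, hω⟩
      exact ⟨Nat.find hex, (Nat.find_min' hex hω).trans_lt hi, Nat.find_spec hex,
        fun j hj => Nat.find_min hex hj⟩
    · rintro ⟨i, hi, hω, -⟩
      exact ⟨i, hi, hω⟩
  have hdisj : Pairwise (Function.onFun Disjoint fun i => Φ ⁻¹' Ioi i ∩ C i) := by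
    refine (pairwise_disjoint_on _).2 fun i j hij => Set.disjoint_left.2 fun ω hi hj => ?_
    exact mem_iInter₂.1 hj.2.2 i (Finset.mem_range.2 hij) hi.2.1
  have hCmeas (i : ℕ) : MeasurableSet (C i) :=
    (hA i).inter (Finset.measurableSet_biInter _ fun j _ => (hA j).compl)
  have hCm (i : ℕ) : MeasurableSet[m] (C i) :=
    (hAm i).inter (Finset.measurableSet_biInter _ fun j _ => (hAm j).compl)
  rw [hset, measure_iUnion hdisj fun i => (hΦ measurableSet_Ioi).inter (hCmeas i),
    ← ENNReal.tsum_mul_left]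
  refine tsum_congr fun i => ?_
  rw [(Indep_iff _ _ P).1 hΦm _ _ ⟨Ioi i, measurableSet_Ioi, rfl⟩ (hCm i),
    measure_inter_biInter_compl_of_iIndepSet hA hind hs]
  ring

/-- Abel-type continuity: `∑ pᵢ (1 - s)ⁱ → ∑ pᵢ` as `s → 0` when the limit is finite. -/
lemma tendsto_tsum_mul_one_sub_pow {α : Type*} {l : Filter α} [l.IsCountablyGenerated]
    {p : ℕ → ℝ≥0∞} (hp : ∑' i, p i ≠ ∞) {s : α → ℝ≥0∞} (hs : Tendsto s l (𝓝 0)) :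
    Tendsto (fun a => ∑' i, p i * (1 - s a) ^ i) l (𝓝 (∑' i, p i)) := by
  simp_rw [← lintegral_count] at hp ⊢
  refine tendsto_lintegral_filter_of_dominated_convergence p
    (Eventually.of_forall fun _ => measurable_from_nat) (Eventually.of_forall fun a => ?_) hp
    (Eventually.of_forall fun i => ?_)
  · exact Eventually.of_forall fun i =>
      mul_le_of_le_one_right' (pow_le_one' tsub_le_self i)
  · have h1 : Tendsto (fun a => 1 - s a) l (𝓝 1) := by
      simpa using ENNReal.Tendsto.sub tendsto_const_nhds hs (Or.inl ENNReal.one_ne_top)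
    have h2 : Tendsto (fun a => (1 - s a) ^ i) l (𝓝 1) := by
      simpa using ENNReal.Tendsto.pow (n := i) h1
    simpa using ENNReal.Tendsto.const_mul (a := p i) h2 (Or.inl one_ne_zero)

/-- Proposition 9: for `Θ = ⋃_{i=1}^Φ E_i` with the `E_i` closed
(here `E i` denotes the `(i+1)`-st set, so indices run over `i < Φ`), the events
`A_i(r) = {x ∈ (E_i)_{⊕r}}` mutually independent with common probability `s(r)`,
`σ(Φ)` independent of all the `A_i(r)`, and `P(x ∈ E_1) = 0`: if
`L = lim_{r↓0} s(r)/(b_{d−n} r^{d−n})` exists in `[0,∞)`, then both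
`P(x ∈ Θ_{⊕r})/(b_{d−n} r^{d−n})` and `E[#{i : x ∈ (E_i)_{⊕r}}]/(b_{d−n} r^{d−n})`
converge to `E[Φ]·L` as `r ↓ 0`. -/
theorem stmt_13 {d n : ℕ} (hnd : n < d)
    {Ω : Type} [MeasurableSpace Ω] (P : Measure Ω) [IsProbabilityMeasure P]
    (Φ : Ω → ℕ) (hΦmeas : Measurable Φ) (hΦ1 : ∀ᵐ ω ∂P, 1 ≤ Φ ω)
    (hΦint : (∫⁻ ω, (Φ ω : ℝ≥0∞) ∂P) < ∞)
    (E : ℕ → Ω → Set (EuclideanSpace ℝ (Fin d)))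
    (hEclosed : ∀ i ω, IsClosed (E i ω))
    (x : EuclideanSpace ℝ (Fin d))
    (hAmeas : ∀ i, ∀ r : ℝ, 0 < r → MeasurableSet {ω | x ∈ enlarge (E i ω) r})
    (hAindep : ∀ r : ℝ, 0 < r →
      ProbabilityTheory.iIndepSet (fun i => {ω | x ∈ enlarge (E i ω) r}) P)
    (s : ℝ → ℝ≥0∞)
    (hs : ∀ i, ∀ r : ℝ, 0 < r → P {ω | x ∈ enlarge (E i ω) r} = s r)
    (hindep : ProbabilityTheory.Indep (MeasurableSpace.comap Φ inferInstance)
      (MeasurableSpace.generateFrom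
        {S : Set Ω | ∃ i, ∃ r : ℝ, 0 < r ∧ S = {ω | x ∈ enlarge (E i ω) r}}) P)
    (hx0 : P {ω | x ∈ E 0 ω} = 0)
    (L : ℝ) (hL : 0 ≤ L)
    (hlim : Tendsto (fun r : ℝ => s r / ENNReal.ofReal (ballVol (d - n) * r ^ (d - n)))
      (𝓝[>] 0) (𝓝 (ENNReal.ofReal L))) :
    Tendsto (fun r : ℝ => P {ω | ∃ i < Φ ω, x ∈ enlarge (E i ω) r} /
        ENNReal.ofReal (ballVol (d - n) * r ^ (d - n)))
      (𝓝[>] 0) (𝓝 ((∫⁻ ω, (Φ ω : ℝ≥0∞) ∂P) * ENNReal.ofReal L)) ∧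
    Tendsto (fun r : ℝ =>
        (∫⁻ ω, ∑ i ∈ Finset.range (Φ ω),
          ({ω' | x ∈ enlarge (E i ω') r}).indicator (fun _ => (1 : ℝ≥0∞)) ω ∂P) /
        ENNReal.ofReal (ballVol (d - n) * r ^ (d - n)))
      (𝓝[>] 0) (𝓝 ((∫⁻ ω, (Φ ω : ℝ≥0∞) ∂P) * ENNReal.ofReal L)) := by
  set c : ℝ → ℝ≥0∞ := fun r => ENNReal.ofReal (ballVol (d - n) * r ^ (d - n)) with hc
  set A : ℝ → ℕ → Set Ω := fun r i => {ω | x ∈ enlarge (E i ω) r}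
  have hmean := lintegral_natCast_eq_tsum_measure_lt P hΦmeas
  have hpos : ∀ᶠ r : ℝ in 𝓝[>] 0, 0 < r := self_mem_nhdsWithin
  have hAm (r : ℝ) (hr : 0 < r) (i : ℕ) : MeasurableSet[MeasurableSpace.generateFrom
      {S : Set Ω | ∃ i, ∃ r : ℝ, 0 < r ∧ S = {ω | x ∈ enlarge (E i ω) r}}] (A r i) :=
    MeasurableSpace.measurableSet_generateFrom ⟨i, r, hr, rfl⟩
  have hc0 : Tendsto c (𝓝[>] 0) (𝓝 0) := by
    have hcont : Continuous c := ENNReal.continuous_ofReal.comp (by fun_prop)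
    have h0 : c 0 = 0 := by simp [hc, (Nat.sub_pos_of_lt hnd).ne']
    simpa only [h0] using (hcont.tendsto 0).mono_left nhdsWithin_le_nhds
  have hs0 : Tendsto s (𝓝[>] 0) (𝓝 0) := by
    have h := ENNReal.Tendsto.mul hlim (Or.inr ENNReal.zero_ne_top) hc0
      (Or.inr ENNReal.ofReal_ne_top)
    rw [mul_zero] at h
    refine h.congr' ?_
    filter_upwards [hpos] with r hr
    exact ENNReal.div_mul_cancel
      (ENNReal.ofReal_pos.2 (mul_pos (ballVol_pos _) (pow_pos hr _))).ne' ENNReal.ofReal_ne_top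
  constructor
  · have hsum := tendsto_tsum_mul_one_sub_pow (hmean ▸ hΦint.ne) hs0
    rw [← hmean] at hsum
    refine (ENNReal.Tendsto.mul hsum (Or.inr ENNReal.ofReal_ne_top) hlim
      (Or.inr hΦint.ne)).congr' ?_
    filter_upwards [hpos] with r hr
    have h := measure_exists_lt_mem_of_iIndepSet hΦmeas (fun i => hAmeas i r hr)
      (hAindep r hr) (fun i => hs i r hr) hindep (hAm r hr)
    simp only [mem_ofPred_eq] at h
    rw [h, mul_comm (s r), mul_div_assoc]
  · refine (ENNReal.Tendsto.const_mul hlim (Or.inr hΦint.ne)).congr' ?_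
    filter_upwards [hpos] with r hr
    rw [lintegral_sum_range_indicator P hΦmeas fun i => hAmeas i r hr, hmean, ← mul_div_assoc,
      ← ENNReal.tsum_mul_right]
    congr 1
    refine tsum_congr fun i => ?_
    rw [(ProbabilityTheory.Indep_iff _ _ P).1 hindep _ _ ⟨Ioi i, measurableSet_Ioi, rfl⟩
      (hAm r hr i), hs i r hr]
end

section
/- Let (Ω, F, P) be a probability space and let 0 ≤ n < d be integers. Let Φ : Ω → ℕ be a random variable with Φ ≥ 1 a.s. and E[Φ] < ∞, and let (E_i)_{i≥1} be maps E_i : Ω → Set(ℝ^d) with each E_i(ω) closed, such that for some fixed x ∈ ℝ^d: for each r > 0 the events A_i(r) := {ω : x ∈ (E_i(ω))_{⊕r}} are measurable and mutually independent with common probability s(r) := P(A_1(r)); the σ-algebra generated by Φ is independent of the σ-algebra generated by all events A_i(r); P(x ∈ E_1) = 0; and the limit L := lim_{r↓0} s(r)/(b_{d−n}·r^{d−n}) exists in [0,∞). Let F_r(x) := {ω : ∃ i ≠ j with i, j ≤ Φ(ω), x ∈ (E_i(ω))_{⊕r} and x ∈ (E_j(ω))_{⊕r}} be the event that x belongs to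 the r-enlargement of at least two of the sets E_1, …, E_Φ. Then lim_{r↓0} P(F_r(x)) / r^{d−n} = 0. -/
open MeasureTheory Metric Filter Set
open scoped ENNReal Topology NNReal

/-- The event that two of the first `k` of the independent, equiprobable events `A i` occur has
probability at most `min (k * s) ((k * s) ^ 2)`. -/
lemma measure_two_of_iIndepSet_le {Ω : Type*} [MeasurableSpace Ω] {P : Measure Ω}
    {A : ℕ → Set Ω} (hA : ProbabilityTheory.iIndepSet A P) {s : ℝ≥0∞} (hs : ∀ i, P (A i) = s)
    (k : ℕ) :
    P {ω | ∃ i < k, ∃ j < k, i ≠ j ∧ ω ∈ A i ∧ ω ∈ A j} ≤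
      s * min (k : ℝ≥0∞) ((k : ℝ≥0∞) ^ 2 * s) := by
  rw [mul_min]
  refine le_min ?_ ?_
  · calc P {ω | ∃ i < k, ∃ j < k, i ≠ j ∧ ω ∈ A i ∧ ω ∈ A j}
        ≤ P (⋃ i ∈ Finset.range k, A i) := by
          refine measure_mono ?_
          rintro ω ⟨i, hi, -, -, -, hωi, -⟩
          exact mem_biUnion (Finset.mem_coe.2 (Finset.mem_range.2 hi)) hωi
      _ ≤ ∑ i ∈ Finset.range k, P (A i) := measure_biUnion_finset_le _ _
      _ = s * k := by simp [hs, mul_comm]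
  · have hpair : ∀ p ∈ (Finset.range k).offDiag, P (A p.1 ∩ A p.2) = s * s := by
      rintro ⟨i, j⟩ hp
      have hij : i ≠ j := (Finset.mem_offDiag.1 hp).2.2
      simpa [Finset.prod_pair hij, hs] using hA.meas_biInter {i, j}
    calc P {ω | ∃ i < k, ∃ j < k, i ≠ j ∧ ω ∈ A i ∧ ω ∈ A j}
        ≤ P (⋃ p ∈ (Finset.range k).offDiag, A p.1 ∩ A p.2) := by
          refine measure_mono ?_
          rintro ω ⟨i, hi, j, hj, hij, hωi, hωj⟩
          simp only [mem_iUnion]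
          exact ⟨(i, j), by simp [hi, hj, hij], hωi, hωj⟩
      _ ≤ ∑ p ∈ (Finset.range k).offDiag, P (A p.1 ∩ A p.2) := measure_biUnion_finset_le _ _
      _ = ((Finset.range k).offDiag.card : ℝ≥0∞) * (s * s) := by
          rw [Finset.sum_congr rfl hpair]; simp
      _ ≤ ((k ^ 2 : ℕ) : ℝ≥0∞) * (s * s) := by
          gcongr
          rw [Finset.offDiag_card, Finset.card_range, sq]
          exact Nat.sub_le _ _
      _ = s * ((k : ℝ≥0∞) ^ 2 * s) := by push_cast; ring

/-- The bound of `measure_two_of_iIndepSet_le` averaged over a random number `Φ` of events which is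
independent of a σ-algebra containing them. -/
lemma measure_two_below_random_index_le {Ω : Type*} {m mΩ : MeasurableSpace Ω}
    {P : Measure Ω} {Φ : Ω → ℕ} (hΦ : Measurable Φ) {A : ℕ → Set Ω}
    (hA : ProbabilityTheory.iIndepSet A P) {s : ℝ≥0∞} (hs : ∀ i, P (A i) = s)
    (hAm : ∀ i, MeasurableSet[m] (A i))
    (hindep : ProbabilityTheory.Indep (MeasurableSpace.comap Φ inferInstance) m P) :
    P {ω | ∃ i < Φ ω, ∃ j < Φ ω, i ≠ j ∧ ω ∈ A i ∧ ω ∈ A j} ≤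
      s * ∫⁻ ω, min (Φ ω : ℝ≥0∞) ((Φ ω : ℝ≥0∞) ^ 2 * s) ∂P := by
  set G : ℕ → Set Ω := fun k => {ω | ∃ i < k, ∃ j < k, i ≠ j ∧ ω ∈ A i ∧ ω ∈ A j} with hG
  have hGm : ∀ k, MeasurableSet[m] (G k) := fun k => by
    have : G k = ⋃ p ∈ (Finset.range k).offDiag, A p.1 ∩ A p.2 := by
      ext ω
      simp only [hG, mem_ofPred_eq, mem_iUnion, Finset.mem_offDiag, Finset.mem_range, mem_inter_iff,
        exists_prop, Prod.exists]
      grind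
    rw [this]
    exact Finset.measurableSet_biUnion _ fun p _ => (hAm p.1).inter (hAm p.2)
  have hint : ∫⁻ ω, min (Φ ω : ℝ≥0∞) ((Φ ω : ℝ≥0∞) ^ 2 * s) ∂P =
      ∑' k : ℕ, min (k : ℝ≥0∞) ((k : ℝ≥0∞) ^ 2 * s) * P (Φ ⁻¹' {k}) := by
    rw [← lintegral_map (f := fun k : ℕ => min (k : ℝ≥0∞) ((k : ℝ≥0∞) ^ 2 * s))
      (measurable_of_countable _) hΦ, lintegral_countable']
    simp_rw [Measure.map_apply hΦ (measurableSet_singleton _)]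
  calc P {ω | ∃ i < Φ ω, ∃ j < Φ ω, i ≠ j ∧ ω ∈ A i ∧ ω ∈ A j}
      ≤ P (⋃ k, Φ ⁻¹' {k} ∩ G k) :=
        measure_mono fun ω hω => mem_iUnion.2 ⟨Φ ω, rfl, hω⟩
    _ ≤ ∑' k, P (Φ ⁻¹' {k} ∩ G k) := measure_iUnion_le _
    _ = ∑' k, P (Φ ⁻¹' {k}) * P (G k) := by
        congr 1 with k
        exact ProbabilityTheory.Indep_iff _ _ _ |>.1 hindep _ _
          ⟨{k}, measurableSet_singleton _, rfl⟩ (hGm k)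
    _ ≤ ∑' k : ℕ, s * (min (k : ℝ≥0∞) ((k : ℝ≥0∞) ^ 2 * s) * P (Φ ⁻¹' {k})) := by
        refine ENNReal.tsum_le_tsum fun k => ?_
        rw [← mul_assoc, mul_comm]
        gcongr
        exact measure_two_of_iIndepSet_le hA hs k
    _ = s * ∫⁻ ω, min (Φ ω : ℝ≥0∞) ((Φ ω : ℝ≥0∞) ^ 2 * s) ∂P := by
        rw [ENNReal.tsum_mul_left, hint]

/-- Dominated convergence for the truncated second moment of an integrable `ℕ`-valued variable. -/
lemma tendsto_lintegral_min_natCast_sq_mul {Ω ι : Type*} [MeasurableSpace Ω] {P : Measure Ω}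
    {Φ : Ω → ℕ} (hΦ : Measurable Φ) (hΦint : ∫⁻ ω, (Φ ω : ℝ≥0∞) ∂P ≠ ∞)
    {l : Filter ι} [l.IsCountablyGenerated] {s : ι → ℝ≥0∞} (hs : Tendsto s l (𝓝 0)) :
    Tendsto (fun r => ∫⁻ ω, min (Φ ω : ℝ≥0∞) ((Φ ω : ℝ≥0∞) ^ 2 * s r) ∂P) l (𝓝 0) := by
  have h := tendsto_lintegral_filter_of_dominated_convergence (μ := P) (l := l)
    (F := fun r ω => min (Φ ω : ℝ≥0∞) ((Φ ω : ℝ≥0∞) ^ 2 * s r)) (f := fun _ => 0)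
    (fun ω => (Φ ω : ℝ≥0∞))
    (Eventually.of_forall fun r => (measurable_of_countable
      fun k : ℕ => min (k : ℝ≥0∞) ((k : ℝ≥0∞) ^ 2 * s r)).comp hΦ)
    (Eventually.of_forall fun r => Eventually.of_forall fun ω => min_le_left _ _) hΦint
    (Eventually.of_forall fun ω => by
      have h1 : Tendsto (fun r => (Φ ω : ℝ≥0∞) ^ 2 * s r) l (𝓝 0) := by
        simpa using ENNReal.Tendsto.const_mul (a := (Φ ω : ℝ≥0∞) ^ 2) hs
          (Or.inr (ENNReal.pow_ne_top (ENNReal.natCast_ne_top _)))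
      exact tendsto_of_tendsto_of_tendsto_of_le_of_le tendsto_const_nhds h1
        (fun _ => zero_le) (fun _ => min_le_right _ _))
  simpa using h

/-- under the hypotheses of Proposition 9 (here `E i` denotes the
`(i+1)`-st set, so indices run over `i < Φ`), the probability `P(F_r(x))` that `x`
belongs to the `r`-enlargement of at least two of the sets `E_1, …, E_Φ` satisfies
`lim_{r↓0} P(F_r(x)) / r^{d−n} = 0`. -/
theorem stmt_15 {d n : ℕ} (hnd : n < d)
    {Ω : Type} [MeasurableSpace Ω] (P : Measure Ω) [IsProbabilityMeasure P]
    (Φ : Ω → ℕ) (hΦmeas : Measurable Φ) (hΦ1 : ∀ᵐ ω ∂P, 1 ≤ Φ ω)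
    (hΦint : (∫⁻ ω, (Φ ω : ℝ≥0∞) ∂P) < ∞)
    (E : ℕ → Ω → Set (EuclideanSpace ℝ (Fin d)))
    (hEclosed : ∀ i ω, IsClosed (E i ω))
    (x : EuclideanSpace ℝ (Fin d))
    (hAmeas : ∀ i, ∀ r : ℝ, 0 < r → MeasurableSet {ω | x ∈ enlarge (E i ω) r})
    (hAindep : ∀ r : ℝ, 0 < r →
      ProbabilityTheory.iIndepSet (fun i => {ω | x ∈ enlarge (E i ω) r}) P)
    (s : ℝ → ℝ≥0∞)
    (hs : ∀ i, ∀ r : ℝ, 0 < r → P {ω | x ∈ enlarge (E i ω) r} = s r)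
    (hindep : ProbabilityTheory.Indep (MeasurableSpace.comap Φ inferInstance)
      (MeasurableSpace.generateFrom
        {S : Set Ω | ∃ i, ∃ r : ℝ, 0 < r ∧ S = {ω | x ∈ enlarge (E i ω) r}}) P)
    (hx0 : P {ω | x ∈ E 0 ω} = 0)
    (L : ℝ) (hL : 0 ≤ L)
    (hlim : Tendsto (fun r : ℝ => s r / ENNReal.ofReal (ballVol (d - n) * r ^ (d - n)))
      (𝓝[>] 0) (𝓝 (ENNReal.ofReal L))) :
    Tendsto (fun r : ℝ =>
        P {ω | ∃ i < Φ ω, ∃ j < Φ ω, i ≠ j ∧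
            x ∈ enlarge (E i ω) r ∧ x ∈ enlarge (E j ω) r} /
          ENNReal.ofReal (r ^ (d - n)))
      (𝓝[>] 0) (𝓝 0) := by
  have hball : 0 < ballVol (d - n) :=
    ENNReal.toReal_pos (measure_closedBall_pos _ _ one_pos).ne' measure_closedBall_lt_top.ne
  set C : ℝ≥0∞ := (ENNReal.ofReal L + 1) * ENNReal.ofReal (ballVol (d - n)) with hC
  have hCtop : C ≠ ∞ := by finiteness
  have hpos : ∀ᶠ r : ℝ in 𝓝[>] 0, 0 < r := self_mem_nhdsWithin
  have hsC : ∀ᶠ r : ℝ in 𝓝[>] 0, s r ≤ C * ENNReal.ofReal (r ^ (d - n)) := by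
    filter_upwards [hpos, hlim.eventually_le_const
      (ENNReal.lt_add_right ENNReal.ofReal_ne_top one_ne_zero)] with r hr hle
    have hb : 0 < ballVol (d - n) * r ^ (d - n) := by positivity
    rw [ENNReal.div_le_iff (by simpa using hb) ENNReal.ofReal_ne_top,
      ENNReal.ofReal_mul hball.le, ← mul_assoc] at hle
    exact hle
  have hpow : Tendsto (fun r : ℝ => ENNReal.ofReal (r ^ (d - n))) (𝓝[>] 0) (𝓝 0) := by
    have h : Tendsto (fun r : ℝ => ENNReal.ofReal (r ^ (d - n))) (𝓝 0)
        (𝓝 (ENNReal.ofReal (0 ^ (d - n)))) :=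
      (ENNReal.continuous_ofReal.comp (continuous_pow _)).tendsto 0
    rw [zero_pow (Nat.sub_pos_of_lt hnd).ne', ENNReal.ofReal_zero] at h
    exact h.mono_left nhdsWithin_le_nhds
  have hs0 : Tendsto s (𝓝[>] 0) (𝓝 0) := by
    have h : Tendsto (fun r : ℝ => C * ENNReal.ofReal (r ^ (d - n))) (𝓝[>] 0) (𝓝 0) := by
      simpa using ENNReal.Tendsto.const_mul hpow (Or.inr hCtop)
    exact tendsto_of_tendsto_of_tendsto_of_le_of_le' tendsto_const_nhds h
      (Eventually.of_forall fun _ => zero_le) hsC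
  have hbound : Tendsto
      (fun r : ℝ => C * ∫⁻ ω, min (Φ ω : ℝ≥0∞) ((Φ ω : ℝ≥0∞) ^ 2 * s r) ∂P) (𝓝[>] 0) (𝓝 0) := by
    simpa using ENNReal.Tendsto.const_mul
      (tendsto_lintegral_min_natCast_sq_mul hΦmeas hΦint.ne hs0) (Or.inr hCtop)
  refine tendsto_of_tendsto_of_tendsto_of_le_of_le' tendsto_const_nhds hbound
    (Eventually.of_forall fun _ => zero_le) ?_
  filter_upwards [hpos, hsC] with r hr hle
  refine ENNReal.div_le_of_le_mul ?_
  calc _ ≤ s r * ∫⁻ ω, min (Φ ω : ℝ≥0∞) ((Φ ω : ℝ≥0∞) ^ 2 * s r) ∂P := by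
        refine measure_two_below_random_index_le hΦmeas (hAindep r hr) (fun i => hs i r hr)
          (fun i => ?_) hindep
        exact MeasurableSpace.measurableSet_generateFrom ⟨i, r, hr, rfl⟩
    _ ≤ C * ENNReal.ofReal (r ^ (d - n)) *
          ∫⁻ ω, min (Φ ω : ℝ≥0∞) ((Φ ω : ℝ≥0∞) ^ 2 * s r) ∂P := by gcongr
    _ = _ := by ring
end
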